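/- arXiv:math/0506085 — 13 statements merged into one kernel-verified Lean document; each statement's English description precedes it below -/
import Mathlib

section
/- Let G be a group, let * be an involutory antiautomorphism of G with g·g* ∈ Z(G) for every g ∈ G, and let g0 ∈ Z(G) satisfy g0* = g0. Define A(g,h) = gh, B(g,h) = hg, C(g,h) = gh*, D(g,h) = g0·h*·g. Then L = Q(G; A, B, C, D) is a Moufang loop, i.e. a loop satisfying x∘(y∘(x∘z)) = ((x∘y)∘x)∘z for all x, y, z ∈ L. Moreover, L is associative if and only if G is commutative. -/
open Function

/-- Multiplication on the disjoint union `G ⊕ G` (first summand: `G`, second: `Gu`)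
determined by four maps `A B C D : G → G → G`. -/
def Qmul {G : Type*} (A B C D : G → G → G) : G ⊕ G → G ⊕ G → G ⊕ G
  | Sum.inl g, Sum.inl h => Sum.inl (A g h)
  | Sum.inl g, Sum.inr h => Sum.inr (B g h)
  | Sum.inr g, Sum.inl h => Sum.inr (C g h)
  | Sum.inr g, Sum.inr h => Sum.inl (D g h)

/-- A magma is a loop with identity `e` if `e` is a two-sided identity and all
left and right translations are bijections. -/
def IsLoopWith {α : Type*} (mul : α → α → α) (e : α) : Prop :=
  (∀ x, mul e x = x) ∧ (∀ x, mul x e = x) ∧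
  (∀ a, Function.Bijective fun x => mul a x) ∧
  (∀ a, Function.Bijective fun x => mul x a)

/-- The eight basic maps `G × G → G` built from `*` (here written `s`). -/
def IsBasic {G : Type*} [Group G] (s : G → G) (ε : G → G → G) : Prop :=
  ε = (fun g h => g * h) ∨ ε = (fun g h => g * s h) ∨
  ε = (fun g h => s g * h) ∨ ε = (fun g h => s g * s h) ∨
  ε = (fun g h => h * g) ∨ ε = (fun g h => h * s g) ∨
  ε = (fun g h => s h * g) ∨ ε = (fun g h => s h * s g)

/-- A map of the form `(g,h) ↦ g0 ^ m * ε (g,h)` for a basic map `ε`. -/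
def IsG0Form {G : Type*} [Group G] (s : G → G) (g0 : G) (X : G → G → G) : Prop :=
  ∃ (m : ℤ) (ε : G → G → G), IsBasic s ε ∧ X = fun g h => g0 ^ m * ε g h

theorem star_mul_self_eq {G : Type*} [Group G] {s : G → G}
    (hcen : ∀ g, g * s g ∈ Subgroup.center G) (g : G) : s g * g = g * s g := by
  have h := Subgroup.mem_center_iff.mp (hcen g) g
  exact (mul_left_cancel (h.trans (mul_assoc g (s g) g))).symm

theorem star_one_of_anti {G : Type*} [Group G] {s : G → G}
    (hanti : ∀ g h, s (g * h) = s h * s g) : s 1 = 1 := by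
  have h := hanti 1 1
  rw [mul_one] at h
  exact left_eq_mul.mp h

theorem qmul_isLoopWith {G : Type*} [Group G] {s : G → G} {g0 : G}
    (hinv : ∀ g, s (s g) = g) (hone : s 1 = 1) :
    IsLoopWith (Qmul (fun g h => g * h) (fun g h => h * g)
      (fun g h => g * s h) (fun g h => g0 * s h * g)) (Sum.inl 1) := by
  have hinj : ∀ a b, s a = s b ↔ a = b := fun a b =>
    (Function.LeftInverse.injective hinv).eq_iff
  refine ⟨?_, ?_, ?_, ?_⟩
  · rintro (x | x) <;> simp [Qmul]
  · rintro (x | x) <;> simp [Qmul, hone]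
  · rintro (a | a)
    · refine ⟨?_, ?_⟩
      · rintro (x | x) (y | y) <;> simp [Qmul]
      · rintro (y | y)
        · exact ⟨Sum.inl (a⁻¹ * y), by simp [Qmul]⟩
        · exact ⟨Sum.inr (y * a⁻¹), by simp [Qmul]⟩
    · refine ⟨?_, ?_⟩
      · rintro (x | x) (y | y) <;> simp [Qmul, hinj]
      · rintro (y | y)
        · exact ⟨Sum.inr (s (g0⁻¹ * y * a⁻¹)), by simp [Qmul, hinv, mul_assoc]⟩
        · exact ⟨Sum.inl (s (a⁻¹ * y)), by simp [Qmul, hinv]⟩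
  · rintro (a | a)
    · refine ⟨?_, ?_⟩
      · rintro (x | x) (y | y) <;> simp [Qmul]
      · rintro (y | y)
        · exact ⟨Sum.inl (y * a⁻¹), by simp [Qmul]⟩
        · exact ⟨Sum.inr (y * (s a)⁻¹), by simp [Qmul]⟩
    · refine ⟨?_, ?_⟩
      · rintro (x | x) (y | y) <;> simp [Qmul]
      · rintro (y | y)
        · exact ⟨Sum.inr ((g0 * s a)⁻¹ * y), by simp [Qmul, mul_assoc]⟩
        · exact ⟨Sum.inl (a⁻¹ * y), by simp [Qmul]⟩

theorem qmul_moufang {G : Type*} [Group G] {s : G → G} {g0 : G}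
    (hinv : ∀ g, s (s g) = g) (hanti : ∀ g h, s (g * h) = s h * s g)
    (hcen : ∀ g, g * s g ∈ Subgroup.center G)
    (hg0 : g0 ∈ Subgroup.center G) (hg0s : s g0 = g0)
    {mul : G ⊕ G → G ⊕ G → G ⊕ G}
    (hmul : mul = Qmul (fun g h => g * h) (fun g h => h * g)
      (fun g h => g * s h) (fun g h => g0 * s h * g)) (x y z : G ⊕ G) :
    mul x (mul y (mul x z)) = mul (mul (mul x y) x) z := by
  subst hmul
  have c0 : ∀ t, t * g0 = g0 * t := Subgroup.mem_center_iff.mp hg0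
  have c0' : ∀ t w, t * (g0 * w) = g0 * (t * w) := fun t w => by
    rw [← mul_assoc, c0, mul_assoc]
  have hstar : ∀ x, ∃ n, s x = n * x⁻¹ ∧ (∀ t, t * n = n * t) ∧
      ∀ t w, t * (n * w) = n * (t * w) := fun x => by
    have h := Subgroup.mem_center_iff.mp (hcen x)
    refine ⟨x * s x, ?_, h, fun t w => ?_⟩
    · rw [← star_mul_self_eq hcen, mul_inv_cancel_right]
    · rw [← mul_assoc, h, mul_assoc]
  rcases x with x | x <;> obtain ⟨n, hn, c, c'⟩ := hstar x <;>
  rcases y with y | y <;> rcases z with z | z <;>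
  simp only [Qmul, hanti, hinv, hg0s, mul_assoc, Sum.inl.injEq, Sum.inr.injEq] <;>
  (try simp only [c0, c0']) <;>
  (try simp only [hn, mul_assoc, c, c', inv_mul_cancel, mul_inv_cancel, mul_one,
    inv_mul_cancel_left, mul_inv_cancel_left])

theorem statement_0 {G : Type*} [Group G] (s : G → G) (g0 : G)
    (hinv : ∀ g, s (s g) = g)
    (hanti : ∀ g h, s (g * h) = s h * s g)
    (hcen : ∀ g, g * s g ∈ Subgroup.center G)
    (hg0 : g0 ∈ Subgroup.center G) (hg0s : s g0 = g0)
    (mul : G ⊕ G → G ⊕ G → G ⊕ G)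
    (hmul : mul = Qmul (fun g h => g * h) (fun g h => h * g)
      (fun g h => g * s h) (fun g h => g0 * s h * g)) :
    (∃ e, IsLoopWith mul e) ∧
    (∀ x y z, mul x (mul y (mul x z)) = mul (mul (mul x y) x) z) ∧
    ((∀ x y z, mul (mul x y) z = mul x (mul y z)) ↔ ∀ a b : G, a * b = b * a) := by
  refine ⟨⟨Sum.inl 1, hmul ▸ qmul_isLoopWith hinv (star_one_of_anti hanti)⟩,
    qmul_moufang hinv hanti hcen hg0 hg0s hmul, ?_, ?_⟩
  · intro h a b
    simpa [hmul, Qmul] using h (Sum.inl a) (Sum.inl b) (Sum.inr 1)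
  · intro hc x y z
    have hlc : ∀ a b c : G, a * (b * c) = b * (a * c) := fun a b c => by
      rw [← mul_assoc, hc a, mul_assoc]
    rcases x with x | x <;> rcases y with y | y <;> rcases z with z | z <;>
      simp only [hmul, Qmul, hanti, hinv, hg0s, Sum.inl.injEq, Sum.inr.injEq] <;>
      simp only [hc, hlc]
end

section
/- Assume g* = g for every g ∈ G (so that G is commutative, since * is an antiautomorphism). Suppose A(g,h) = gh for all g, h, and each of B, C, D is of the form (g,h) ↦ g0^n·gh for some integer n. If L = Q(G; A, B, C, D) is a loop, then L is an abelian group, i.e. the multiplication ∘ on L is associative and commutative. -/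
open Function

theorem statement_5 {G : Type*} [Group G] (s : G → G) (g0 : G)
    (hinv : ∀ g, s (s g) = g)
    (hanti : ∀ g h, s (g * h) = s h * s g)
    (hcen : ∀ g, g * s g ∈ Subgroup.center G)
    (hg0 : g0 ∈ Subgroup.center G) (hg0s : s g0 = g0)
    (hid : ∀ g, s g = g)
    (A B C D : G → G → G)
    (hA : A = fun g h => g * h)
    (hB : ∃ n : ℤ, B = fun g h => g0 ^ n * (g * h))
    (hC : ∃ n : ℤ, C = fun g h => g0 ^ n * (g * h))
    (hD : ∃ n : ℤ, D = fun g h => g0 ^ n * (g * h))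
    (e : G ⊕ G) (he : IsLoopWith (Qmul A B C D) e) :
    (∀ x y z, Qmul A B C D (Qmul A B C D x y) z
        = Qmul A B C D x (Qmul A B C D y z)) ∧
    (∀ x y, Qmul A B C D x y = Qmul A B C D y x) := by
  have hcomm : ∀ g h : G, g * h = h * g := fun g h => by
    simpa only [hid] using hanti g h
  obtain ⟨b, hB⟩ := hB
  obtain ⟨c, hC⟩ := hC
  obtain ⟨d, hD⟩ := hD
  obtain ⟨hleft, hright, -, -⟩ := he
  subst hA hB hC hD
  rcases e with e | e
  · have he : e = 1 := by simpa [Qmul] using hleft (Sum.inl 1)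
    subst he
    have hb : g0 ^ b = 1 := by simpa [Qmul] using hleft (Sum.inr 1)
    have hc : g0 ^ c = 1 := by simpa [Qmul] using hright (Sum.inr 1)
    let _ : CommGroup G := { mul_comm := hcomm }
    refine ⟨?_, ?_⟩
    · rintro (x | x) (y | y) (z | z) <;>
        simp only [Qmul, hb, hc, one_mul, mul_assoc, mul_left_comm]
    · rintro (x | x) (y | y) <;> simp only [Qmul, hb, hc, one_mul, hcomm x y]
  · exact absurd (hleft (Sum.inl 1)) Sum.inr_ne_inl
end

section
/- Assume * is not the identity map on G. Suppose A equals one of the four maps (g,h) ↦ gh, gh*, g*h, g*h*, and each of B, C, D is of the form (g,h) ↦ g0^n·ε(g,h) for some integer n and some basic map ε. Then L = Q(G; A, B, C, D) is a loop if and only if A(g,h) = gh for all g, h, B equals (as a map G × G → G) one of (g,h) ↦ gh, g*h, hg, hg*, and C equals one of (g,h) ↦ gh, gh*, hg, h*g. -/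
open Function

/-- Both families of translations of a binary map consist of bijections. -/
def BijTranslations {α : Type*} (X : α → α → α) : Prop :=
  (∀ a, Bijective fun x => X a x) ∧ (∀ a, Bijective fun x => X x a)

theorem BijTranslations.qmul {G : Type*} {A B C D : G → G → G}
    (hA : BijTranslations A) (hB : BijTranslations B)
    (hC : BijTranslations C) (hD : BijTranslations D) :
    BijTranslations (Qmul A B C D) := by
  have swap : Bijective (Sum.swap : G ⊕ G → G ⊕ G) := (Equiv.sumComm G G).bijective
  refine ⟨fun a => ?_, fun a => ?_⟩ <;> rcases a with a | a
  · convert Sum.map_bijective.2 ⟨hA.1 a, hB.1 a⟩ using 1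
    ext (x | x) <;> rfl
  · convert swap.comp (Sum.map_bijective.2 ⟨hC.1 a, hD.1 a⟩) using 1
    ext (x | x) <;> rfl
  · convert Sum.map_bijective.2 ⟨hA.2 a, hC.2 a⟩ using 1
    ext (x | x) <;> rfl
  · convert swap.comp (Sum.map_bijective.2 ⟨hB.2 a, hD.2 a⟩) using 1
    ext (x | x) <;> rfl

section

variable {G : Type*} [Group G] {s : G → G}

theorem bijTranslations_mul : BijTranslations fun g h : G => g * h :=
  ⟨Group.mulLeft_bijective, Group.mulRight_bijective⟩

theorem BijTranslations.flip {α : Type*} {X : α → α → α} (hX : BijTranslations X) :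
    BijTranslations fun g h => X h g :=
  ⟨hX.2, hX.1⟩

theorem BijTranslations.comp_left {α : Type*} {X : α → α → α} (hX : BijTranslations X)
    {f : α → α} (hf : Bijective f) : BijTranslations fun g h => X (f g) h :=
  ⟨fun a => hX.1 (f a), fun a => (hX.2 a).comp hf⟩

theorem BijTranslations.comp_right {α : Type*} {X : α → α → α} (hX : BijTranslations X)
    {f : α → α} (hf : Bijective f) : BijTranslations fun g h => X g (f h) :=
  (hX.flip.comp_left hf).flip

theorem IsBasic.bijTranslations {ε : G → G → G} (hs : Bijective s) (hε : IsBasic s ε) :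
    BijTranslations ε := by
  have mul := bijTranslations_mul (G := G)
  rcases hε with rfl | rfl | rfl | rfl | rfl | rfl | rfl | rfl
  · exact mul
  · exact mul.comp_right hs
  · exact mul.comp_left hs
  · exact (mul.comp_left hs).comp_right hs
  · exact mul.flip
  · exact (mul.comp_right hs).flip
  · exact (mul.comp_left hs).flip
  · exact ((mul.comp_left hs).comp_right hs).flip

theorem IsG0Form.bijTranslations {g0 : G} {X : G → G → G} (hs : Bijective s)
    (hX : IsG0Form s g0 X) : BijTranslations X := by
  obtain ⟨m, ε, hε, rfl⟩ := hX
  have h := hε.bijTranslations hs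
  exact ⟨fun a => (Group.mulLeft_bijective _).comp (h.1 a),
    fun a => (Group.mulLeft_bijective _).comp (h.2 a)⟩

theorem IsG0Form.isBasic {g0 : G} {X : G → G → G} (hs1 : s 1 = 1)
    (hX : IsG0Form s g0 X) (h1 : X 1 1 = 1) : IsBasic s X := by
  obtain ⟨m, ε, hε, rfl⟩ := hX
  have hε1 : ε 1 1 = 1 := by
    rcases hε with rfl | rfl | rfl | rfl | rfl | rfl | rfl | rfl <;> simp [hs1]
  have hm : g0 ^ m = 1 := by simpa [hε1] using h1
  simpa [hm] using hε

theorem IsBasic.eq_of_one_left {X : G → G → G} (hs1 : s 1 = 1) (hne : s ≠ id)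
    (hX : IsBasic s X) (h : ∀ x, X 1 x = x) :
    X = (fun g h => g * h) ∨ X = (fun g h => s g * h) ∨
      X = (fun g h => h * g) ∨ X = (fun g h => h * s g) := by
  have hs : ¬ ∀ x, s x = x := fun h => hne (funext h)
  rcases hX with rfl | rfl | rfl | rfl | rfl | rfl | rfl | rfl <;> simp_all

theorem IsBasic.eq_of_one_right {X : G → G → G} (hs1 : s 1 = 1) (hne : s ≠ id)
    (hX : IsBasic s X) (h : ∀ x, X x 1 = x) :
    X = (fun g h => g * h) ∨ X = (fun g h => g * s h) ∨
      X = (fun g h => h * g) ∨ X = (fun g h => s h * g) := by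
  have hs : ¬ ∀ x, s x = x := fun h => hne (funext h)
  rcases hX with rfl | rfl | rfl | rfl | rfl | rfl | rfl | rfl <;> simp_all

end

theorem statement_6 {G : Type*} [Group G] (s : G → G) (g0 : G)
    (hinv : ∀ g, s (s g) = g)
    (hanti : ∀ g h, s (g * h) = s h * s g)
    (hcen : ∀ g, g * s g ∈ Subgroup.center G)
    (hg0 : g0 ∈ Subgroup.center G) (hg0s : s g0 = g0)
    (hne : s ≠ id)
    (A B C D : G → G → G)
    (hA : A = (fun g h => g * h) ∨ A = (fun g h => g * s h) ∨
          A = (fun g h => s g * h) ∨ A = (fun g h => s g * s h))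
    (hB : IsG0Form s g0 B) (hC : IsG0Form s g0 C) (hD : IsG0Form s g0 D) :
    (∃ e, IsLoopWith (Qmul A B C D) e) ↔
      (A = (fun g h => g * h) ∧
       (B = (fun g h => g * h) ∨ B = (fun g h => s g * h) ∨
        B = (fun g h => h * g) ∨ B = (fun g h => h * s g)) ∧
       (C = (fun g h => g * h) ∨ C = (fun g h => g * s h) ∨
        C = (fun g h => h * g) ∨ C = (fun g h => s h * g))) := by
  have hs : Bijective s := Involutive.bijective hinv
  have hs1 : s 1 = 1 := by simpa using hanti 1 1
  constructor
  · rintro ⟨e | e, hl, hr, -, -⟩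
    · have hAl : ∀ x, A e x = x := fun x => Sum.inl_injective (hl (.inl x))
      have hAr : ∀ x, A x e = x := fun x => Sum.inl_injective (hr (.inl x))
      have hBl : ∀ x, B e x = x := fun x => Sum.inr_injective (hl (.inr x))
      have hCr : ∀ x, C x e = x := fun x => Sum.inr_injective (hr (.inr x))
      have hns : ¬ ∀ x, s x = x := fun h => hne (funext h)
      have he : e = 1 := by
        have hl1 := hAl 1
        have hr1 := hAr 1
        rcases hA with rfl | rfl | rfl | rfl <;> simp_all
      subst he
      refine ⟨?_, (hB.isBasic hs1 (hBl 1)).eq_of_one_left hs1 hne hBl,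
        (hC.isBasic hs1 (hCr 1)).eq_of_one_right hs1 hne hCr⟩
      rcases hA with rfl | rfl | rfl | rfl <;> simp_all
    · exact absurd (hl (.inl e)) Sum.inr_ne_inl
  · rintro ⟨rfl, hB', hC'⟩
    obtain ⟨hl, hr⟩ := bijTranslations_mul.qmul (hB.bijTranslations hs)
      (hC.bijTranslations hs) (hD.bijTranslations hs)
    refine ⟨.inl 1, ?_, ?_, hl, hr⟩
    · rintro (x | x)
      · simp [Qmul]
      · rcases hB' with rfl | rfl | rfl | rfl <;> simp [Qmul, hs1]
    · rintro (x | x)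
      · simp [Qmul]
      · rcases hC' with rfl | rfl | rfl | rfl <;> simp [Qmul, hs1]
end

section
/- Let A : G × G → G be arbitrary, let D be of the form (g,h) ↦ g0^n·ε(g,h) for some integer n and basic map ε, and set D'(g,h) = D(g*,h*). Suppose the pair (B, B') of maps G × G → G is one of ((g,h)↦gh, (g,h)↦hg*), ((g,h)↦hg, (g,h)↦g*h), ((g,h)↦g*h, (g,h)↦hg), ((g,h)↦hg*, (g,h)↦gh), and the pair (C, C') is one of ((g,h)↦gh, (g,h)↦h*g), ((g,h)↦hg, (g,h)↦gh*), ((g,h)↦gh*, (g,h)↦hg), ((g,h)↦h*g, (g,h)↦gh). Then the map f : G ⊔ Gu → G ⊔ Gu defined by f(g) = g and f(gu) = g*u is an isomorphism of Q(G; A, B, C, D) onto Q(G; A, B', C', D'). -/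
open Function

theorem statement_7 {G : Type*} [Group G] (s : G → G) (g0 : G)
    (hinv : ∀ g, s (s g) = g)
    (hanti : ∀ g h, s (g * h) = s h * s g)
    (hcen : ∀ g, g * s g ∈ Subgroup.center G)
    (hg0 : g0 ∈ Subgroup.center G) (hg0s : s g0 = g0)
    (A B C D B' C' : G → G → G)
    (hD : IsG0Form s g0 D)
    (hBB' : (B = (fun g h => g * h) ∧ B' = (fun g h => h * s g)) ∨
            (B = (fun g h => h * g) ∧ B' = (fun g h => s g * h)) ∨
            (B = (fun g h => s g * h) ∧ B' = (fun g h => h * g)) ∨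
            (B = (fun g h => h * s g) ∧ B' = (fun g h => g * h)))
    (hCC' : (C = (fun g h => g * h) ∧ C' = (fun g h => s h * g)) ∨
            (C = (fun g h => h * g) ∧ C' = (fun g h => g * s h)) ∨
            (C = (fun g h => g * s h) ∧ C' = (fun g h => h * g)) ∨
            (C = (fun g h => s h * g) ∧ C' = (fun g h => g * h)))
    (f : G ⊕ G → G ⊕ G) (hf : f = Sum.map id s) :
    Function.Bijective f ∧
    ∀ x y, f (Qmul A B C D x y)
      = Qmul A B' C' (fun g h => D (s g) (s h)) (f x) (f y) := by
  subst hf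
  refine ⟨bijective_id.sumMap (Involutive.bijective hinv), ?_⟩
  have hB : ∀ g h, s (B g h) = B' g (s h) := by
    rcases hBB' with ⟨rfl, rfl⟩ | ⟨rfl, rfl⟩ | ⟨rfl, rfl⟩ | ⟨rfl, rfl⟩ <;> simp [hanti, hinv]
  have hC : ∀ g h, s (C g h) = C' (s g) h := by
    rcases hCC' with ⟨rfl, rfl⟩ | ⟨rfl, rfl⟩ | ⟨rfl, rfl⟩ | ⟨rfl, rfl⟩ <;> simp [hanti, hinv]
  rintro (g | g) (h | h) <;> simp [Qmul, hB, hC, hinv]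
end

section
/- Let L = Q(G; A, B, C, D) with A(g,h) = gh, B(g,h) = gh, C(g,h) = h*g, D(g,h) = g0·g·h* (the construction of de Barros and Juriaans). Then L is a flexible loop, i.e. a loop satisfying x∘(y∘x) = (x∘y)∘x for all x, y ∈ L. -/
open Function

theorem statement_8 {G : Type*} [Group G] (s : G → G) (g0 : G)
    (hinv : ∀ g, s (s g) = g)
    (hanti : ∀ g h, s (g * h) = s h * s g)
    (hcen : ∀ g, g * s g ∈ Subgroup.center G)
    (hg0 : g0 ∈ Subgroup.center G) (hg0s : s g0 = g0)
    (mul : G ⊕ G → G ⊕ G → G ⊕ G)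
    (hmul : mul = Qmul (fun g h => g * h) (fun g h => g * h)
      (fun g h => s h * g) (fun g h => g0 * g * s h)) :
    (∃ e, IsLoopWith mul e) ∧
    (∀ x y, mul x (mul y x) = mul (mul x y) x) := by
  have hs1 : s 1 = 1 := by
    have h := hanti 1 1
    rw [mul_one] at h
    exact left_eq_mul.mp h
  have hsinj : Injective s := LeftInverse.injective hinv
  have hcomm : ∀ g, s g * g = g * s g := fun g => by
    have h := Subgroup.mem_center_iff.mp (hcen g) (s g)
    rw [← mul_assoc] at h
    exact mul_right_cancel h
  have hz : ∀ k, k * g0 = g0 * k := Subgroup.mem_center_iff.mp hg0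
  subst hmul
  refine ⟨⟨Sum.inl 1, ?_, ?_, ?_, ?_⟩, ?_⟩
  · rintro (g | g) <;> simp [Qmul]
  · rintro (g | g) <;> simp [Qmul, hs1]
  · intro a
    refine ⟨?_, ?_⟩
    · rcases a with a | a <;> rintro (g | g) (h | h) <;> simp [Qmul, hsinj.eq_iff]
    · rcases a with a | a <;> rintro (g | g)
      · exact ⟨Sum.inl (a⁻¹ * g), by simp [Qmul]⟩
      · exact ⟨Sum.inr (a⁻¹ * g), by simp [Qmul]⟩
      · exact ⟨Sum.inr (s ((g0 * a)⁻¹ * g)), by simp only [Qmul, hinv, mul_inv_cancel_left]⟩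
      · exact ⟨Sum.inl (s (g * a⁻¹)), by simp [Qmul, hinv]⟩
  · intro a
    refine ⟨?_, ?_⟩
    · rcases a with a | a <;> rintro (g | g) (h | h) <;> simp [Qmul]
    · rcases a with a | a <;> rintro (g | g)
      · exact ⟨Sum.inl (g * a⁻¹), by simp [Qmul]⟩
      · exact ⟨Sum.inr ((s a)⁻¹ * g), by simp [Qmul]⟩
      · exact ⟨Sum.inr (g0⁻¹ * (g * (s a)⁻¹)), by simp [Qmul, mul_assoc]⟩
      · exact ⟨Sum.inl (g * a⁻¹), by simp [Qmul]⟩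
  · rintro (g | g) (h | h) <;> simp only [Qmul, Sum.inl.injEq, Sum.inr.injEq]
    · exact (mul_assoc _ _ _).symm
    · rw [← mul_assoc, ← mul_assoc, hcomm]
    · have hc := Subgroup.mem_center_iff.mp (hcen g) (s h)
      rw [hanti]
      simp only [mul_assoc] at hc ⊢
      rw [hc]
    · rw [hanti, hanti, hinv, hg0s, ← mul_assoc, hz, ← mul_assoc]
end

section
/- Let L = Q(G; A, B, C, D) with A(g,h) = gh, B(g,h) = gh, C(g,h) = h*g, D(g,h) = g0·g·h* (the construction of de Barros and Juriaans). Then L is a C-loop, i.e. satisfies x∘(y∘(y∘z)) = ((x∘y)∘y)∘z for all x, y, z ∈ L, if and only if G/Z(G) is an elementary abelian 2-group, i.e. g² ∈ Z(G) for every g ∈ G. -/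
open Function

theorem statement_10 {G : Type*} [Group G] (s : G → G) (g0 : G)
    (hinv : ∀ g, s (s g) = g)
    (hanti : ∀ g h, s (g * h) = s h * s g)
    (hcen : ∀ g, g * s g ∈ Subgroup.center G)
    (hg0 : g0 ∈ Subgroup.center G) (hg0s : s g0 = g0)
    (mul : G ⊕ G → G ⊕ G → G ⊕ G)
    (hmul : mul = Qmul (fun g h => g * h) (fun g h => g * h)
      (fun g h => s h * g) (fun g h => g0 * g * s h)) :
    (∀ x y z, mul x (mul y (mul y z)) = mul (mul (mul x y) y) z) ↔
      (∀ g : G, g ^ 2 ∈ Subgroup.center G) := by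
  subst hmul
  have cg : ∀ x, x * g0 = g0 * x := Subgroup.mem_center_iff.mp hg0
  have cN : ∀ b x, x * (b * s b) = b * s b * x := fun b => Subgroup.mem_center_iff.mp (hcen b)
  have sN : ∀ b, s b * b = b * s b := fun b =>
    mul_left_cancel (a := b) (by rw [← mul_assoc, cN])
  constructor
  · intro H g
    rw [Subgroup.mem_center_iff]
    intro a
    have h := H (Sum.inr a) (Sum.inl (s g)) (Sum.inr 1)
    have s1 : s 1 = 1 := by simpa using hanti 1 1
    simpa [Qmul, hanti, hinv, s1, mul_assoc, pow_two] using h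
  · intro H x y z
    have c2 : ∀ g x, x * (g * g) = g * g * x := fun g x => by
      simpa [pow_two] using Subgroup.mem_center_iff.mp (H g) x
    rcases x with a | a <;> rcases y with b | b <;> rcases z with c | c <;>
      simp only [Qmul, hanti, hinv, hg0s, Sum.inl.injEq, Sum.inr.injEq]
    · simp only [mul_assoc]
    · simp only [mul_assoc]
    · simp only [mul_assoc, ← cg]
    · calc a * (c * (s b * g0) * b) = a * (c * (g0 * (s b * b))) := by
            simp only [cg (s b), mul_assoc]
        _ = a * g0 * (c * (b * s b)) := by rw [sN, ← mul_assoc c, cg c]; simp only [mul_assoc]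
        _ = g0 * (a * b) * s b * c := by rw [cN, cg a]; simp only [mul_assoc]
    · simp only [mul_assoc]
    · grind [c2 (s b) a, c2 (s b) (s c)]
    · rw [mul_assoc (g0 * a), sN, mul_assoc g0, cN, ← cg]
      simp only [mul_assoc, ← cg]
    · grind [cg a, cg b, cg (s b)]
end

section
/- The following conditions on G are equivalent: (i) g² ∈ Z(G) for every g ∈ G (i.e. G/Z(G) is an elementary abelian 2-group); (ii) x·x·y = y·x·x for all x, y ∈ G; (iii) x·y·x* = x*·y·x for all x, y ∈ G. -/
open Function

/-- If `x * s` is central, then `x * y * s = s * y * x` holds exactly when `x * x` commutes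
with `y`. -/
theorem mul_mul_eq_mul_mul_iff_of_mul_mem_center {G : Type*} [Group G] {x s : G}
    (h : x * s ∈ Subgroup.center G) (y : G) :
    x * y * s = s * y * x ↔ x * x * y = y * x * x := by
  obtain ⟨c, rfl⟩ : ∃ c, s = x⁻¹ * c := ⟨x * s, by group⟩
  rw [mul_inv_cancel_left, Subgroup.mem_center_iff] at h
  have hr : x⁻¹ * c * y * x = x⁻¹ * y * x * c := by
    rw [mul_assoc x⁻¹ c y, ← h y, mul_assoc, mul_assoc y c x, ← h x]
    group
  rw [hr, ← mul_assoc, mul_left_inj, mul_inv_eq_iff_eq_mul, ← mul_right_inj x]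
  simp only [mul_assoc, mul_inv_cancel_left]

theorem statement_11 {G : Type*} [Group G] (s : G → G)
    (hinv : ∀ g, s (s g) = g)
    (hanti : ∀ g h, s (g * h) = s h * s g)
    (hcen : ∀ g, g * s g ∈ Subgroup.center G) :
    ((∀ g : G, g ^ 2 ∈ Subgroup.center G) ↔
      (∀ x y : G, x * x * y = y * x * x)) ∧
    ((∀ x y : G, x * x * y = y * x * x) ↔
      (∀ x y : G, x * y * s x = s x * y * x)) := by
  refine ⟨forall_congr' fun x => ?_, forall_congr' fun x => forall_congr' fun y =>
    (mul_mul_eq_mul_mul_iff_of_mul_mem_center (hcen x) y).symm⟩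
  rw [Subgroup.mem_center_iff]
  exact forall_congr' fun y => by rw [pow_two, ← mul_assoc, eq_comm]
end

section
/- The following conditions on G are equivalent: (i) G is commutative; (ii) x·x*·y = x*·y·x for all x, y ∈ G. -/
open Function

theorem statement_12 {G : Type*} [Group G] (s : G → G)
    (hinv : ∀ g, s (s g) = g)
    (hanti : ∀ g h, s (g * h) = s h * s g)
    (hcen : ∀ g, g * s g ∈ Subgroup.center G) :
    (∀ a b : G, a * b = b * a) ↔ (∀ x y : G, x * s x * y = s x * y * x) := by
  refine ⟨fun h x y => ?_, fun h a b => ?_⟩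
  · rw [h x (s x), mul_assoc, h x y, ← mul_assoc]
  · have hcomm : a * s a = s a * a := by simpa using h a 1
    have hab := h a b
    rw [hcomm, mul_assoc, mul_assoc] at hab
    exact mul_left_cancel hab
end

section
/- The following conditions on G are equivalent: (i) x·x·y = y·x*·x* for all x, y ∈ G; (ii) (x·x)* = x·x for every x ∈ G and g² ∈ Z(G) for every g ∈ G (i.e. G/Z(G) is an elementary abelian 2-group). -/
open Function

theorem statement_13 {G : Type*} [Group G] (s : G → G)
    (hinv : ∀ g, s (s g) = g)
    (hanti : ∀ g h, s (g * h) = s h * s g)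
    (hcen : ∀ g, g * s g ∈ Subgroup.center G) :
    (∀ x y : G, x * x * y = y * s x * s x) ↔
      ((∀ x : G, s (x * x) = x * x) ∧ (∀ g : G, g ^ 2 ∈ Subgroup.center G)) := by
  simp only [hanti, Subgroup.mem_center_iff, pow_two]
  constructor
  · intro h
    have hsq (x : G) : s x * s x = x * x := by simpa using (h x 1).symm
    refine ⟨hsq, fun g y => ?_⟩
    rw [h g y, mul_assoc, hsq]
  · rintro ⟨hsq, hc⟩ x y
    rw [mul_assoc y, hsq, hc]
end

section
/- Assume * is not the identity map, A(g,h) = gh, B equals (as a map G × G → G) one of (g,h) ↦ gh, g*h, hg, hg*, C equals one of (g,h) ↦ gh, hg, and D equals (g,h) ↦ g0·ε(g,h) for one of the eight basic maps ε. Then the loop L = Q(G; A, B, C, D) is associative if and only if either (B, C, D) = ((g,h)↦gh, (g,h)↦gh, (g,h)↦g0·gh) (as maps), or G is commutative and (B, C, D) = ((g,h)↦g*h, (g,h)↦gh, (g,h)↦g0·g*h) (as maps). -/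
open Function

/-- The value of a basic map at `(1, 1)` is `1`. -/
theorem IsBasic.apply_one_one {G : Type*} [Group G] {s : G → G} {ε : G → G → G}
    (hε : IsBasic s ε) (hs : s 1 = 1) : ε 1 1 = 1 := by
  rcases hε with rfl | rfl | rfl | rfl | rfl | rfl | rfl | rfl <;> simp [hs]

/-- Associativity of `Qmul` unfolded over the two summands. -/
theorem Qmul_assoc_iff {G : Type*} (A B C D : G → G → G) :
    (∀ x y z, Qmul A B C D (Qmul A B C D x y) z = Qmul A B C D x (Qmul A B C D y z)) ↔
      (∀ g h k, A (A g h) k = A g (A h k)) ∧ (∀ g h k, B (A g h) k = B g (B h k)) ∧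
      (∀ g h k, C (B g h) k = B g (C h k)) ∧ (∀ g h k, D (B g h) k = A g (D h k)) ∧
      (∀ g h k, C (C g h) k = C g (A h k)) ∧ (∀ g h k, D (C g h) k = D g (B h k)) ∧
      (∀ g h k, A (D g h) k = D g (C h k)) ∧ (∀ g h k, B (D g h) k = C g (D h k)) := by
  simp only [Sum.forall, Qmul, Sum.inl.injEq, Sum.inr.injEq, forall_and]
  tauto

theorem statement_14 {G : Type*} [Group G] (s : G → G) (g0 : G)
    (hinv : ∀ g, s (s g) = g)
    (hanti : ∀ g h, s (g * h) = s h * s g)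
    (hcen : ∀ g, g * s g ∈ Subgroup.center G)
    (hg0 : g0 ∈ Subgroup.center G) (hg0s : s g0 = g0)
    (hne : s ≠ id)
    (B C D : G → G → G)
    (hB : B = (fun g h => g * h) ∨ B = (fun g h => s g * h) ∨
          B = (fun g h => h * g) ∨ B = (fun g h => h * s g))
    (hC : C = (fun g h => g * h) ∨ C = (fun g h => h * g))
    (hD : ∃ ε : G → G → G, IsBasic s ε ∧ D = fun g h => g0 * ε g h)
    (mul : G ⊕ G → G ⊕ G → G ⊕ G)
    (hmul : mul = Qmul (fun g h => g * h) B C D) :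
    (∀ x y z, mul (mul x y) z = mul x (mul y z)) ↔
      ((B = (fun g h => g * h) ∧ C = (fun g h => g * h) ∧
          D = (fun g h => g0 * (g * h))) ∨
       ((∀ a b : G, a * b = b * a) ∧
          B = (fun g h => s g * h) ∧ C = (fun g h => g * h) ∧
          D = (fun g h => g0 * (s g * h)))) := by
  subst hmul
  rw [Qmul_assoc_iff]
  have hs1 : s 1 = 1 := by simpa [hinv] using (hanti 1 (s 1)).symm
  have hD1 : D 1 1 = g0 := by
    obtain ⟨ε, hε, rfl⟩ := hD
    simp [hε.apply_one_one hs1]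
  have hg0c : ∀ g, g * g0 = g0 * g := Subgroup.mem_center_iff.mp hg0
  constructor
  · rintro ⟨-, hABB, hCB, hDB, hCCA, -, hDC, -⟩
    have hC' : C = fun g h => g * h := by
      rcases hC with rfl | rfl
      · rfl
      · funext g h
        simpa using hCCA 1 g h
    subst hC'
    have hDr : ∀ g k, D g k = D g 1 * k := fun g k => by simpa using (hDC g 1 k).symm
    have hB' : B = (fun g h => g * h) ∨
        ((∀ a b : G, a * b = b * a) ∧ B = fun g h => s g * h) := by
      rcases hB with rfl | rfl | rfl | rfl
      · exact Or.inl rfl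
      · refine Or.inr ⟨fun a b => ?_, rfl⟩
        simpa [hanti, hinv] using hABB (s b) (s a) 1
      · refine Or.inl ?_
        funext g h
        simpa using hABB h g 1
      · have hcomm : ∀ a b : G, a * b = b * a := fun a b => by
          simpa [hinv] using (hCB (s b) 1 a).symm
        exact Or.inr ⟨hcomm, funext₂ fun g h => hcomm h (s g)⟩
    rcases hB' with rfl | ⟨hcomm, rfl⟩
    · refine Or.inl ⟨rfl, rfl, funext₂ fun g h => ?_⟩
      have h1 : D g 1 = g * g0 := by simpa [hD1] using hDB g 1 1
      rw [hDr, h1, hg0c, mul_assoc]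
    · refine Or.inr ⟨hcomm, rfl, rfl, funext₂ fun g h => ?_⟩
      have h1 : D g 1 = s g * g0 := by simpa [hD1, hinv] using hDB (s g) 1 1
      rw [hDr, h1, hg0c, mul_assoc]
  · rintro (⟨rfl, rfl, rfl⟩ | ⟨hcomm, rfl, rfl, rfl⟩)
    · simp [mul_assoc, ← mul_assoc _ g0, hg0c]
    · let _ : CommGroup G := { mul_comm := hcomm }
      simp only [hanti, hinv, hg0s]
      refine ⟨?_, ?_, ?_, ?_, ?_, ?_, ?_, ?_⟩ <;> intro g h k <;> ac_rfl
end

section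
/- Assume * is not the identity map, A(g,h) = gh, B equals (as a map G × G → G) one of (g,h) ↦ gh, g*h, hg, hg*, C equals one of (g,h) ↦ gh, hg, and D equals (g,h) ↦ g0·ε(g,h) for one of the eight basic maps ε. Then the loop L = Q(G; A, B, C, D) is an extra loop, i.e. satisfies x∘(y∘(z∘x)) = ((x∘y)∘z)∘x for all x, y, z ∈ L, if and only if L is associative or [g² ∈ Z(G) for every g ∈ G and (B, C, D) = ((g,h)↦g*h, (g,h)↦hg, (g,h)↦g0·h·g*) as maps]. -/
open Function

section AntiautomorphismLemmas

variable {G : Type*} [Group G] {s : G → G}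

theorem antiautomorphism_one (hanti : ∀ g h, s (g * h) = s h * s g) : s 1 = 1 := by
  simpa using hanti 1 1

theorem commute_antiautomorphism (hcen : ∀ g, g * s g ∈ Subgroup.center G) (x : G) :
    s x * x = x * s x := by
  have h := Subgroup.mem_center_iff.1 (hcen x) x
  rw [mul_assoc] at h
  exact (mul_left_cancel h).symm

/-- If squares are central, the two ways of placing `x` and `s x` around `w` agree. -/
theorem antiautomorphism_mul_mul_self (hcen : ∀ g, g * s g ∈ Subgroup.center G)
    (hsq : ∀ g : G, g ^ 2 ∈ Subgroup.center G) (x w : G) :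
    s x * (w * x) = x * (w * s x) := by
  have h1 := Subgroup.mem_center_iff.1 (hcen x)
  have h2 := Subgroup.mem_center_iff.1 (hsq x)
  apply mul_left_cancel (a := x)
  apply mul_right_cancel (b := x)
  calc x * (s x * (w * x)) * x = (x * s x) * (w * x ^ 2) := by
        simp only [mul_assoc, pow_two]
    _ = (w * x ^ 2) * (x * s x) := (h1 _).symm
    _ = (x ^ 2 * w) * (x * s x) := by rw [h2 w]
    _ = x * (x * (w * s x)) * x := by
        simp only [mul_assoc, pow_two, commute_antiautomorphism hcen]

end AntiautomorphismLemmas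

section Extra

variable {G : Type*} [Group G] {s : G → G} {g0 : G}

theorem Qmul_assoc (hg0 : g0 ∈ Subgroup.center G) (x y z : G ⊕ G) :
    let mul := Qmul (fun g h : G => g * h) (fun g h => g * h) (fun g h => g * h)
      (fun g h => g0 * (g * h))
    mul (mul x y) z = mul x (mul y z) := by
  have hc (w : G) : w * g0 = g0 * w := Subgroup.mem_center_iff.1 hg0 w
  have hc' (w v : G) : w * (g0 * v) = g0 * (w * v) := by
    rw [← mul_assoc, hc, mul_assoc]
  rcases x with x | x <;> rcases y with y | y <;> rcases z with z | z <;>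
    simp [Qmul, mul_assoc, hc']

theorem Qmul_extra (hinv : ∀ g, s (s g) = g) (hanti : ∀ g h, s (g * h) = s h * s g)
    (hcen : ∀ g, g * s g ∈ Subgroup.center G) (hg0 : g0 ∈ Subgroup.center G) (hg0s : s g0 = g0)
    (hsq : ∀ g : G, g ^ 2 ∈ Subgroup.center G) (x y z : G ⊕ G) :
    let mul := Qmul (fun g h : G => g * h) (fun g h => s g * h) (fun g h => h * g)
      (fun g h => g0 * (h * s g))
    mul x (mul y (mul z x)) = mul (mul (mul x y) z) x := by
  have hc (w : G) : w * g0 = g0 * w := Subgroup.mem_center_iff.1 hg0 w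
  have hc' (w v : G) : w * (g0 * v) = g0 * (w * v) := by
    rw [← mul_assoc, hc, mul_assoc]
  have hm' (x w v : G) : s x * (w * (x * v)) = x * (w * (s x * v)) := by
    simpa [mul_assoc] using congrArg (· * v) (antiautomorphism_mul_mul_self hcen hsq x w)
  have hN (x w : G) : w * (x * s x) = x * (s x * w) := by
    rw [Subgroup.mem_center_iff.1 (hcen x) w, mul_assoc]
  have hS (x w : G) : w * (x * x) = x * (x * w) := by
    simpa [pow_two, mul_assoc] using Subgroup.mem_center_iff.1 (hsq x) w
  rcases x with x | x <;> rcases y with y | y <;> rcases z with z | z <;>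
    simp [Qmul, mul_assoc, hanti, hinv, hg0s, hc, hc']
  · exact hm' x (s y) z
  · exact hm' x z y
  · simpa [mul_assoc] using (hS x (z * s y)).symm
  · simpa [mul_assoc] using hN x (s y * s z)

end Extra

section Converse

variable {G : Type*} [Group G] {s : G → G} {g0 : G}

theorem sq_mem_center_of_conj (hcen : ∀ g, g * s g ∈ Subgroup.center G)
    (h : ∀ x w, s x * (w * x) = x * (w * s x)) (g : G) : g ^ 2 ∈ Subgroup.center G := by
  refine Subgroup.mem_center_iff.2 fun w => ?_
  have h1 := Subgroup.mem_center_iff.1 (hcen g)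
  apply mul_right_cancel (b := g * s g)
  calc w * g ^ 2 * (g * s g) = (g * s g) * (w * g ^ 2) := h1 _
    _ = g * (s g * (w * g)) * g := by simp only [mul_assoc, pow_two]
    _ = g ^ 2 * w * (g * s g) := by
        simp only [h, mul_assoc, pow_two, commute_antiautomorphism hcen]

theorem extra_B_C (hinv : ∀ g, s (s g) = g) (hanti : ∀ g h, s (g * h) = s h * s g)
    (hcen : ∀ g, g * s g ∈ Subgroup.center G) {B C : G → G → G}
    (hB : B = (fun g h => g * h) ∨ B = (fun g h => s g * h) ∨
          B = (fun g h => h * g) ∨ B = (fun g h => h * s g))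
    (hC : C = (fun g h => g * h) ∨ C = (fun g h => h * g))
    (h1 : ∀ x y z, B x (B y (C z x)) = C (B (x * y) z) x)
    (h2 : ∀ x y z, B x (C y (z * x)) = C (C (B x y) z) x) :
    (B = (fun g h => g * h) ∧ C = fun g h => g * h) ∨
      (B = (fun g h => s g * h) ∧ C = (fun g h => h * g) ∧
        ∀ g : G, g ^ 2 ∈ Subgroup.center G) := by
  have hsc := commute_antiautomorphism hcen
  have hsq : (∀ p q : G, p * q = q * p) → ∀ g : G, g ^ 2 ∈ Subgroup.center G := fun hc g =>
    Subgroup.mem_center_iff.2 fun w => hc _ _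
  by_cases hcomm : ∀ p q : G, p * q = q * p
  · have hC' : C = (fun g h => g * h) ∧ C = (fun g h => h * g) := by
      have : (fun g h : G => g * h) = fun g h => h * g := by
        funext g h; exact hcomm g h
      rcases hC with rfl | rfl
      exacts [⟨rfl, this⟩, ⟨this.symm, rfl⟩]
    have e1 : (fun g h : G => h * g) = fun g h => g * h := by
      funext g h; exact hcomm h g
    have e2 : (fun g h : G => h * s g) = fun g h => s g * h := by
      funext g h; exact hcomm h (s g)
    rw [e1, e2] at hB
    rcases hB with hB | hB | hB | hB
    · exact Or.inl ⟨hB, hC'.1⟩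
    · exact Or.inr ⟨hB, hC'.2, hsq hcomm⟩
    · exact Or.inl ⟨hB, hC'.1⟩
    · exact Or.inr ⟨hB, hC'.2, hsq hcomm⟩
  · rcases hB with rfl | rfl | rfl | rfl <;> rcases hC with rfl | rfl <;>
      simp only [hanti, mul_assoc, mul_right_inj] at h1 h2
    · exact Or.inl ⟨rfl, rfl⟩
    · exact absurd (fun p q => by simpa using h1 q p 1) hcomm
    · exact absurd (fun p q => by simpa [hinv] using h1 (s p) (s q) (s p)⁻¹) hcomm
    · exact Or.inr ⟨rfl, rfl, sq_mem_center_of_conj hcen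
        fun x w => by simpa [hinv] using h1 x (s w) 1⟩
    · exact absurd (fun p q => by simpa [← mul_assoc] using h2 q 1 p) hcomm
    · exact absurd (fun p q => by simpa using h1 q p 1) hcomm
    · exact absurd (fun p q => by simpa [hsc, hinv, ← mul_assoc] using h1 p (s q) 1) hcomm
    · exact absurd (fun p q => by simpa [← mul_assoc] using h2 q 1 p) hcomm

theorem extra_D_of_mul (hanti : ∀ g h, s (g * h) = s h * s g)
    (hg0 : g0 ∈ Subgroup.center G) (hne : ∃ x, s x ≠ x) {ε : G → G → G}
    (hε : IsBasic s ε)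
    (h3 : ∀ x y z, x * (g0 * ε y (z * x)) = g0 * ε (x * y) z * x)
    (h4 : ∀ x y z, x * (y * (g0 * ε z x)) = g0 * ε (x * y) z * x) :
    ε = fun g h => g * h := by
  have hc (w v : G) : w * (g0 * v) = g0 * (w * v) := by
    rw [← mul_assoc, Subgroup.mem_center_iff.1 hg0 w, mul_assoc]
  have hs1 := antiautomorphism_one hanti
  obtain ⟨a, ha⟩ := hne
  rcases hε with rfl | rfl | rfl | rfl | rfl | rfl | rfl | rfl <;>
    simp only [hanti, hc, mul_assoc, mul_right_inj] at h3 h4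
  · rfl
  · exact absurd (by simpa [hs1] using h3 a 1 1) ha
  · exact absurd (by simpa [hs1, eq_comm] using h3 a 1 1) ha
  · exact absurd (by simpa [hs1, eq_comm] using h4 1 a 1) ha
  · funext x z
    exact (by simpa [← mul_assoc] using h3 x 1 z : x * z = z * x).symm
  · exact absurd (by simpa [hs1, eq_comm] using h3 a 1 1) ha
  · exact absurd (by simpa [hs1, eq_comm] using h3 a 1 1) ha
  · exact absurd (by simpa [hs1, eq_comm] using h4 1 a 1) ha

theorem extra_D_of_star_mul (hinv : ∀ g, s (s g) = g) (hanti : ∀ g h, s (g * h) = s h * s g)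
    (hg0 : g0 ∈ Subgroup.center G) (hg0s : s g0 = g0) (hne : ∃ x, s x ≠ x) {ε : G → G → G}
    (hε : IsBasic s ε)
    (h3 : ∀ x y z, x * (g0 * ε y (x * z)) = g0 * ε (s x * y) z * x)
    (h4 : ∀ x y z, y * (g0 * ε z x) * x = s (g0 * ε (y * x) z) * x) :
    ε = fun g h => h * s g := by
  have hc (w v : G) : w * (g0 * v) = g0 * (w * v) := by
    rw [← mul_assoc, Subgroup.mem_center_iff.1 hg0 w, mul_assoc]
  have hc0 (w : G) : w * g0 = g0 * w := Subgroup.mem_center_iff.1 hg0 w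
  have hs1 := antiautomorphism_one hanti
  obtain ⟨a, ha⟩ := hne
  rcases hε with rfl | rfl | rfl | rfl | rfl | rfl | rfl | rfl <;>
    simp only [hanti, hinv, hg0s, hc, hc0, mul_assoc, mul_right_inj] at h3 h4
  · exact absurd (by simpa [hs1, eq_comm] using h3 a 1 1) ha
  · exact absurd (by simpa [hs1, eq_comm] using h4 1 a 1) ha
  · funext x z
    simpa [hs1] using h3 (s x) 1 z
  · exact absurd (by simpa [hs1, eq_comm] using h3 a 1 1) ha
  · exact absurd (by simpa [hs1, eq_comm] using h3 a 1 1) ha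
  · rfl
  · exact absurd (by simpa [hs1, eq_comm] using h4 1 a 1) ha
  · exact absurd (by simpa [hs1, eq_comm] using h3 a 1 1) ha

end Converse

theorem statement_15 {G : Type*} [Group G] (s : G → G) (g0 : G)
    (hinv : ∀ g, s (s g) = g)
    (hanti : ∀ g h, s (g * h) = s h * s g)
    (hcen : ∀ g, g * s g ∈ Subgroup.center G)
    (hg0 : g0 ∈ Subgroup.center G) (hg0s : s g0 = g0)
    (hne : s ≠ id)
    (B C D : G → G → G)
    (hB : B = (fun g h => g * h) ∨ B = (fun g h => s g * h) ∨
          B = (fun g h => h * g) ∨ B = (fun g h => h * s g))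
    (hC : C = (fun g h => g * h) ∨ C = (fun g h => h * g))
    (hD : ∃ ε : G → G → G, IsBasic s ε ∧ D = fun g h => g0 * ε g h)
    (mul : G ⊕ G → G ⊕ G → G ⊕ G)
    (hmul : mul = Qmul (fun g h => g * h) B C D) :
    (∀ x y z, mul x (mul y (mul z x)) = mul (mul (mul x y) z) x) ↔
      ((∀ x y z, mul (mul x y) z = mul x (mul y z)) ∨
       ((∀ g : G, g ^ 2 ∈ Subgroup.center G) ∧
          B = (fun g h => s g * h) ∧ C = (fun g h => h * g) ∧
          D = (fun g h => g0 * (h * s g)))) := by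
  subst hmul
  constructor
  · intro hx
    have hne' : ∃ x, s x ≠ x := by
      simpa [funext_iff] using hne
    have h1 : ∀ x y z, B x (B y (C z x)) = C (B (x * y) z) x := fun x y z =>
      Sum.inr.inj (hx (.inl x) (.inl y) (.inr z))
    have h2 : ∀ x y z, B x (C y (z * x)) = C (C (B x y) z) x := fun x y z =>
      Sum.inr.inj (hx (.inl x) (.inr y) (.inl z))
    have h3 : ∀ x y z, x * D y (C z x) = D (B x y) z * x := fun x y z =>
      Sum.inl.inj (hx (.inl x) (.inr y) (.inr z))
    have h4 : ∀ x y z, C x (y * D z x) = B (D (C x y) z) x := fun x y z =>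
      Sum.inr.inj (hx (.inr x) (.inl y) (.inr z))
    obtain ⟨ε, hε, rfl⟩ := hD
    rcases extra_B_C hinv hanti hcen hB hC h1 h2 with ⟨rfl, rfl⟩ | ⟨rfl, rfl, hsq⟩
    · obtain rfl := extra_D_of_mul hanti hg0 hne' hε h3 h4
      exact Or.inl (Qmul_assoc hg0)
    · obtain rfl := extra_D_of_star_mul hinv hanti hg0 hg0s hne' hε h3 h4
      exact Or.inr ⟨hsq, rfl, rfl, rfl⟩
  · rintro (h | ⟨hsq, rfl, rfl, rfl⟩) x y z
    · simp only [h]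
    · exact Qmul_extra hinv hanti hcen hg0 hg0s hsq x y z
end

section
/- Assume * is not the identity map, A(g,h) = gh, B equals (as a map G × G → G) one of (g,h) ↦ gh, g*h, hg, hg*, C equals one of (g,h) ↦ gh, hg, and D equals (g,h) ↦ g0·ε(g,h) for one of the eight basic maps ε. Then the loop L = Q(G; A, B, C, D) is a Moufang loop, i.e. satisfies x∘(y∘(x∘z)) = ((x∘y)∘x)∘z for all x, y, z ∈ L, if and only if L is associative or (B, C, D) = ((g,h)↦g*h, (g,h)↦hg, (g,h)↦g0·h·g*) as maps. -/
open Function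

/-- A twisted product `g0 * ε` satisfying two Moufang consequences, in which `b` is the
identity or the involution `s`, must be `g0 * (b g * h)` or `g0 * (h * b g)`. -/
theorem IsBasic.eq_of_moufang {G : Type*} [Group G] {s : G → G} {g0 : G}
    (hinv : ∀ g, s (s g) = g) (hanti : ∀ g h, s (g * h) = s h * s g) (hne : s ≠ id)
    {ε D : G → G → G} {b : G → G} (hb : b = id ∨ b = s) (hε : IsBasic s ε)
    (hD : D = fun g h => g0 * ε g h)
    (h₁ : ∀ a, a * ε 1 (b a) = ε (b a * a) 1) (h₂ : ∀ a, ε 1 (b a) = ε a 1) :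
    D = (fun g h => g0 * (b g * h)) ∨ D = (fun g h => g0 * (h * b g)) := by
  have hs1 : s 1 = 1 := by
    have h := hanti 1 1
    simpa using h
  subst hD
  rcases hb with rfl | rfl <;> rcases hε with rfl | rfl | rfl | rfl | rfl | rfl | rfl | rfl
  all_goals first
    | exact .inl rfl
    | exact .inr rfl
    | exact absurd (funext fun a => by simpa [hinv, hanti, hs1] using h₂ a) hne
    | exact absurd (funext fun a => by simpa [hinv, hanti, hs1] using (h₂ a).symm) hne
    | exact absurd (funext fun a => by simpa [hinv, hanti, hs1] using h₁ a) hne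
    | exact absurd (funext fun a => by simpa [hinv, hanti, hs1] using (h₁ a).symm) hne

/-- Over a commutative group, the doubling with `B g h = b g * h` and `D g h = g0 * (b g * h)` for
a multiplicative involution `b` fixing `g0` is associative. -/
theorem Qmul_assoc_of_comm {G : Type*} [Group G] (hcomm : ∀ a c : G, a * c = c * a)
    {b : G → G} {g0 : G} (hbb : ∀ g, b (b g) = g) (hb : ∀ g h, b (g * h) = b g * b h)
    (hg0 : b g0 = g0) (x y z : G ⊕ G) :
    let mul := Qmul (fun g h : G => g * h) (fun g h => b g * h) (fun g h => g * h)
      (fun g h => g0 * (b g * h))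
    mul (mul x y) z = mul x (mul y z) := by
  have hleft : ∀ a c d : G, a * (c * d) = c * (a * d) := fun a c d => by
    rw [← mul_assoc, hcomm a c, mul_assoc]
  rcases x with x | x <;> rcases y with y | y <;> rcases z with z | z <;>
    simp only [Qmul, hbb, hb, hg0, mul_assoc]
  all_goals simp only [hcomm, hleft]

/-- If `g0` is central, the doubling of a group by `g0` is associative. -/
theorem Qmul_assoc_of_central {G : Type*} [Group G] {g0 : G} (hg0 : ∀ g, g * g0 = g0 * g)
    (x y z : G ⊕ G) :
    let mul := Qmul (fun g h : G => g * h) (fun g h => g * h) (fun g h => g * h)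
      (fun g h => g0 * (g * h))
    mul (mul x y) z = mul x (mul y z) := by
  have hleft : ∀ g h, g * (g0 * h) = g0 * (g * h) := fun g h => by
    rw [← mul_assoc, hg0, mul_assoc]
  rcases x with x | x <;> rcases y with y | y <;> rcases z with z | z <;>
    simp only [Qmul, mul_assoc, hleft]

/-- The doubling with `B g h = g* h`, `C g h = h g`, `D g h = g0 h g*` is a Moufang magma. -/
theorem Qmul_moufang {G : Type*} [Group G] {s : G → G} {g0 : G}
    (hinv : ∀ g, s (s g) = g) (hanti : ∀ g h, s (g * h) = s h * s g)
    (hcen : ∀ g h, h * (g * s g) = g * s g * h) (hg0 : ∀ g, g * g0 = g0 * g) (hg0s : s g0 = g0)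
    (x y z : G ⊕ G) :
    let mul := Qmul (fun g h : G => g * h) (fun g h => s g * h) (fun g h => h * g)
      (fun g h => g0 * (h * s g))
    mul x (mul y (mul x z)) = mul (mul (mul x y) x) z := by
  have hleft : ∀ g h, g * (g0 * h) = g0 * (g * h) := fun g h => by
    rw [← mul_assoc, hg0, mul_assoc]
  have hcomm : ∀ g, s g * g = g * s g := fun g => by
    have h := hcen g g
    simpa [mul_assoc] using h.symm
  have hcomm' : ∀ g h, s g * (g * h) = g * (s g * h) := fun g h => by
    rw [← mul_assoc, hcomm, mul_assoc]
  have hcen' : ∀ g h, h * (g * s g) = g * (s g * h) := fun g h => by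
    rw [hcen, mul_assoc]
  have hcen'' : ∀ g h k, h * (g * (s g * k)) = g * (s g * (h * k)) := fun g h k => by
    rw [← mul_assoc g, ← mul_assoc h, hcen, mul_assoc, mul_assoc]
  rcases x with x | x <;> rcases y with y | y <;> rcases z with z | z <;>
    simp only [Qmul, hinv, hanti, hg0, hg0s, mul_assoc, hleft, hcomm, hcomm']
  all_goals simp only [hcen' x, hcen'' x]

theorem statement_16 {G : Type*} [Group G] (s : G → G) (g0 : G)
    (hinv : ∀ g, s (s g) = g)
    (hanti : ∀ g h, s (g * h) = s h * s g)
    (hcen : ∀ g, g * s g ∈ Subgroup.center G)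
    (hg0 : g0 ∈ Subgroup.center G) (hg0s : s g0 = g0)
    (hne : s ≠ id)
    (B C D : G → G → G)
    (hB : B = (fun g h => g * h) ∨ B = (fun g h => s g * h) ∨
          B = (fun g h => h * g) ∨ B = (fun g h => h * s g))
    (hC : C = (fun g h => g * h) ∨ C = (fun g h => h * g))
    (hD : ∃ ε : G → G → G, IsBasic s ε ∧ D = fun g h => g0 * ε g h)
    (mul : G ⊕ G → G ⊕ G → G ⊕ G)
    (hmul : mul = Qmul (fun g h => g * h) B C D) :
    (∀ x y z, mul x (mul y (mul x z)) = mul (mul (mul x y) x) z) ↔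
      ((∀ x y z, mul (mul x y) z = mul x (mul y z)) ∨
       (B = (fun g h => s g * h) ∧ C = (fun g h => h * g) ∧
          D = (fun g h => g0 * (h * s g)))) := by
  have hs1 : s 1 = 1 := by
    have h := hanti 1 1
    simpa using h
  have hg0c : ∀ g, g * g0 = g0 * g := Subgroup.mem_center_iff.1 hg0
  have hcen' : ∀ g h, h * (g * s g) = g * s g * h := fun g => Subgroup.mem_center_iff.1 (hcen g)
  have hcomm : ∀ g, s g * g = g * s g := fun g => by
    have h := hcen' g g
    simpa [mul_assoc] using h.symm
  obtain ⟨ε, hε, hD⟩ := hD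
  subst hmul
  constructor
  · intro hM
    have hGUG : ∀ a b c, B a (C b (a * c)) = C (C (B a b) a) c := fun a b c =>
      Sum.inr.inj (hM (Sum.inl a) (Sum.inr b) (Sum.inl c))
    have hGUU : ∀ a b c, a * D b (B a c) = D (C (B a b) a) c := fun a b c =>
      Sum.inl.inj (hM (Sum.inl a) (Sum.inr b) (Sum.inr c))
    have hUGG : ∀ a b c, D a (B b (C a c)) = D (C a b) a * c := fun a b c =>
      Sum.inl.inj (hM (Sum.inr a) (Sum.inl b) (Sum.inl c))
    clear hM
    obtain ⟨b, hb, hBb⟩ : ∃ b : G → G, (b = id ∨ b = s) ∧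
        (B = (fun g h => b g * h) ∨ B = fun g h => h * b g) := by
      rcases hB with h | h | h | h
      · exact ⟨id, .inl rfl, .inl h⟩
      · exact ⟨s, .inr rfl, .inl h⟩
      · exact ⟨id, .inl rfl, .inr h⟩
      · exact ⟨s, .inr rfl, .inr h⟩
    have hB1 : ∀ a, B a 1 = b a := by rcases hBb with rfl | rfl <;> simp
    have hb1 : b 1 = 1 := by rcases hb with rfl | rfl <;> simp [hs1]
    have hbb : ∀ g, b (b g) = g := by rcases hb with rfl | rfl <;> simp [hinv]
    have hbc : ∀ g, g * b g = b g * g := by rcases hb with rfl | rfl <;> simp [hcomm]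
    have hDb := hε.eq_of_moufang hinv hanti hne hb hD
      (fun a => by
        have h := hGUU a 1 1
        have hC' : C (b a) a = b a * a := by rcases hC with rfl | rfl <;> simp [hbc]
        rw [hB1, hC', hD, ← mul_assoc, hg0c] at h
        simpa [mul_assoc] using h)
      (fun a => by
        have h := hUGG 1 a 1
        have hC' : C 1 a = a := by rcases hC with rfl | rfl <;> simp
        have hC'' : C 1 1 = (1 : G) := by rcases hC with rfl | rfl <;> simp
        rw [hC'', hB1, hC', hD] at h
        simpa using h)
    clear hB hD hε hGUU
    by_cases hab : ∀ a c : G, a * c = c * a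
    · left
      have hB' : B = fun g h => b g * h := by rcases hBb with rfl | rfl <;> simp [hab]
      have hC' : C = fun g h => g * h := by rcases hC with rfl | rfl <;> simp [hab]
      have hD' : D = fun g h => g0 * (b g * h) := by rcases hDb with rfl | rfl <;> simp [hab]
      subst hB' hC' hD'
      refine Qmul_assoc_of_comm hab hbb ?_ ?_
      · rcases hb with rfl | rfl
        · simp
        · intro g h
          rw [hanti, hab]
      · rcases hb with rfl | rfl <;> simp [hg0s]
    · have hB' : B = fun g h => b g * h := by
        refine hBb.resolve_right fun hB' => hab fun a c => ?_
        subst hB'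
        rcases hC with rfl | rfl
        · have h := hGUG (b a) 1 c
          have h' : a * (b a * c) = b a * (c * a) := by simpa [hbb, mul_assoc] using h.symm
          rwa [← mul_assoc, hbc, mul_assoc, mul_right_inj] at h'
        · simpa [← mul_assoc] using hGUG a 1 c
      subst hB'
      rcases hb with rfl | rfl <;> rcases hC with rfl | rfl <;> rcases hDb with rfl | rfl
      · exact .inl (Qmul_assoc_of_central hg0c)
      · exact absurd (fun a c => by simpa [mul_assoc] using (hUGG a 1 c).symm) hab
      · exact absurd (fun a c => by simpa [mul_assoc] using hUGG c 1 a) hab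
      · refine absurd (fun a c => ?_) hab
        have h : g0 * a * c = g0 * c * a := by
          simpa [← mul_assoc] using (hUGG a c 1).symm
        rwa [mul_assoc, mul_assoc, mul_right_inj] at h
      · refine absurd (fun a c => ?_) hab
        have h : g0 * a * c = g0 * c * a := by
          simpa [hinv, hanti, ← mul_assoc] using hUGG (b a) (b c) 1
        rwa [mul_assoc, mul_assoc, mul_right_inj] at h
      · exact absurd (fun a c => by simpa [hinv, hb1, mul_assoc] using (hUGG (b a) 1 c).symm) hab
      · exact absurd (fun a c => by simpa [hs1, mul_assoc] using (hUGG a 1 c).symm) hab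
      · exact .inr ⟨rfl, rfl, rfl⟩
  · rintro (h | ⟨rfl, rfl, rfl⟩) x y z
    · simp only [h]
    · exact Qmul_moufang hinv hanti hcen' hg0c hg0s x y z
end

section
/- Suppose each of A, B, C, D : G × G → G is of the form (g,h) ↦ g0^m·ε(g,h) for some integer m and some basic map ε, and suppose L = Q(G; A, B, C, D) is a loop with identity element e. Then L has two-sided inverses: for every x ∈ L there exists y ∈ L with x∘y = e = y∘x. -/
open Function

/-- For a central element `k` fixed by the antiautomorphism `s`, the equation `ε g h = k` has a
solution `h` that also solves `ε h g = k`. -/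
lemma IsBasic.exists_two_sided_eq {G : Type*} [Group G] {s : G → G} {ε : G → G → G}
    (hε : IsBasic s ε) (hinv : ∀ g, s (s g) = g) (hanti : ∀ g h, s (g * h) = s h * s g)
    {k : G} (hk : k ∈ Subgroup.center G) (hks : s k = k) (g : G) :
    ∃ h, ε g h = k ∧ ε h g = k := by
  have hcomm : ∀ x, x * k = k * x := Subgroup.mem_center_iff.mp hk
  have hs_one : s 1 = 1 := by simpa using hanti 1 1
  have hs_inv : ∀ x, s x⁻¹ = (s x)⁻¹ := fun x =>
    eq_inv_of_mul_eq_one_left (by rw [← hanti, mul_inv_cancel, hs_one])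
  rcases hε with rfl | rfl | rfl | rfl | rfl | rfl | rfl | rfl
  all_goals first
    | refine ⟨k * g⁻¹, ?_, ?_⟩ <;> simp [hanti, hs_inv, hks, hcomm, ← mul_assoc]; done
    | refine ⟨k * (s g)⁻¹, ?_, ?_⟩ <;> simp [hanti, hs_inv, hinv, hks, hcomm, ← mul_assoc]

/-- If `z⁻¹` is fixed by `s`, then `z * ε c 1 = 1` forces `c = z⁻¹`. -/
lemma IsBasic.eq_inv_of_mul_apply_one {G : Type*} [Group G] {s : G → G} {ε : G → G → G}
    (hε : IsBasic s ε) (hinv : ∀ g, s (s g) = g) (hanti : ∀ g h, s (g * h) = s h * s g)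
    {z c : G} (hzs : s z⁻¹ = z⁻¹) (h : z * ε c 1 = 1) : c = z⁻¹ := by
  have hs_one : s 1 = 1 := by simpa using hanti 1 1
  have hstar : s c = z⁻¹ → c = z⁻¹ := fun hc => by rw [← hinv c, hc, hzs]
  rcases hε with rfl | rfl | rfl | rfl | rfl | rfl | rfl | rfl
  all_goals
    simp only [hs_one, mul_one, one_mul] at h
    first
      | exact eq_inv_of_mul_eq_one_right h
      | exact hstar (eq_inv_of_mul_eq_one_right h)

theorem statement_19 {G : Type*} [Group G] (s : G → G) (g0 : G)
    (hinv : ∀ g, s (s g) = g)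
    (hanti : ∀ g h, s (g * h) = s h * s g)
    (hcen : ∀ g, g * s g ∈ Subgroup.center G)
    (hg0 : g0 ∈ Subgroup.center G) (hg0s : s g0 = g0)
    (A B C D : G → G → G)
    (hA : IsG0Form s g0 A) (hB : IsG0Form s g0 B)
    (hC : IsG0Form s g0 C) (hD : IsG0Form s g0 D)
    (e : G ⊕ G) (he : IsLoopWith (Qmul A B C D) e) :
    ∀ x, ∃ y, Qmul A B C D x y = e ∧ Qmul A B C D y x = e := by
  have hs_one : s 1 = 1 := by simpa using hanti 1 1
  let F : G →* Gᵐᵒᵖ :=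
    { toFun := fun g => MulOpposite.op (s g)
      map_one' := by rw [hs_one, MulOpposite.op_one]
      map_mul' := fun g h => by rw [hanti, MulOpposite.op_mul] }
  have hs_zpow : ∀ n : ℤ, s (g0 ^ n) = g0 ^ n := fun n => by
    have h := map_zpow F g0 n
    change MulOpposite.op (s (g0 ^ n)) = MulOpposite.op (s g0) ^ n at h
    rwa [hg0s, ← MulOpposite.op_zpow, MulOpposite.op_inj] at h
  have hsolve : ∀ n : ℤ, ∀ X, IsG0Form s g0 X → ∀ g, ∃ h, X g h = g0 ^ n ∧ X h g = g0 ^ n := by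
    rintro n X ⟨m, ε, hε, rfl⟩ g
    obtain ⟨h, h₁, h₂⟩ := hε.exists_two_sided_eq hinv hanti
      (Subgroup.zpow_mem _ hg0 (n - m)) (hs_zpow _) g
    exact ⟨h, by simp only [h₁, ← zpow_add, add_sub_cancel],
      by simp only [h₂, ← zpow_add, add_sub_cancel]⟩
  obtain ⟨hleft, -⟩ := he
  rcases e with c | c
  · obtain ⟨n, rfl⟩ : ∃ n : ℤ, c = g0 ^ n := by
      obtain ⟨m, ε, hε, rfl⟩ := hA
      refine ⟨-m, ?_⟩
      rw [zpow_neg]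
      exact hε.eq_inv_of_mul_apply_one hinv hanti (by rw [← zpow_neg, hs_zpow])
        (Sum.inl.inj (hleft (Sum.inl 1)))
    rintro (g | g)
    · obtain ⟨h, h₁, h₂⟩ := hsolve n A hA g
      exact ⟨Sum.inl h, congrArg Sum.inl h₁, congrArg Sum.inl h₂⟩
    · obtain ⟨h, h₁, h₂⟩ := hsolve n D hD g
      exact ⟨Sum.inr h, congrArg Sum.inl h₁, congrArg Sum.inl h₂⟩
  · exact absurd (hleft (Sum.inr c)) Sum.inl_ne_inr
end
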